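/- arXiv:hep-th/9810078 — 7 statements merged into one kernel-verified Lean document; each statement's English description precedes it below -/
import Mathlib

section
/- Suppose h¹ : Fin r → Fin r → Fin r → ℝ is symmetric in its last two indices (h¹ a b c = h¹ a c b for all a,b,c). Then the following are equivalent: (1) for all a, b, c: 2·(h¹ c a b) = −(f a b c)·(m c) + 2·(f' b c a)·(m b); (2) the conjunction of: for all a, b, c, 2·(h¹ c a b) = (f' b c a)·(m b) + (f' a c b)·(m a), and relation (f-f') holds. (Taking the symmetric part of equation (4) in a and b yields the explicit expression (h1) for h⁽¹⁾, and the antisymmetric part yields the consistency relation (f-f').) -/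
/-- Taking the symmetric part of equation (4) in `a` and `b` yields the explicit
expression (h1) for `h⁽¹⁾`, and the antisymmetric part yields the consistency
relation (f-f'). -/
theorem stmt_4 (r : ℕ) (m : Fin r → ℝ) (f f' h1 : Fin r → Fin r → Fin r → ℝ)
    (hf1 : ∀ a b c, f a b c = -f b a c) (hf2 : ∀ a b c, f a b c = -f a c b)
    (hf' : ∀ a b c, f' a b c = -f' b a c)
    (hh1 : ∀ a b c, h1 a b c = h1 a c b) :
    (∀ a b c, 2 * h1 c a b = -(f a b c) * m c + 2 * f' b c a * m b) ↔
      ((∀ a b c, 2 * h1 c a b = f' b c a * m b + f' a c b * m a) ∧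
       (∀ a b c, f a b c * m c = f' c a b * m a - f' c b a * m b)) := by
  constructor
  · intro h
    have swapped : ∀ a b c, 2 * h1 c a b = f a b c * m c + 2 * f' a c b * m a := by
      intro a b c
      rw [hh1 c a b, h b a c, hf1 b a c, neg_neg]
    refine ⟨fun a b c => ?_, fun a b c => ?_⟩
    · linarith [h a b c, swapped a b c]
    · rw [hf' c a b, hf' c b a]
      linarith [h a b c, swapped a b c]
  · rintro ⟨hsymm, hanti⟩ a b c
    have hfm := hanti a b c
    rw [hf' c a b, hf' c b a] at hfm
    linarith [hsymm a b c]
end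

section
/- Assume relation (f-f') holds. Then for all a, b, c: (m a)·( (f' c a b)·(m c) + (f' b a c)·(m b) ) = (f b a c)·( (m b)² − (m c)² ). (Substituting the expression (h1), namely h⁽¹⁾_{abc} = ½(f'_{cab} m_c + f'_{bac} m_b), into equation (1), 2 h⁽¹⁾_{abc} m_a = f_{bac}(m_b² − m_c²), yields an identity.) -/
/-- Substituting the expression (h1), `h⁽¹⁾_{abc} = ½(f'_{cab} m_c + f'_{bac} m_b)`,
into equation (1), `2 h⁽¹⁾_{abc} m_a = f_{bac}(m_b² − m_c²)`, yields an identity. -/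
theorem stmt_5 (r : ℕ) (m : Fin r → ℝ) (f f' : Fin r → Fin r → Fin r → ℝ)
    (hf1 : ∀ a b c, f a b c = -f b a c) (hf2 : ∀ a b c, f a b c = -f a c b)
    (hf' : ∀ a b c, f' a b c = -f' b a c)
    (hff' : ∀ a b c, f a b c * m c = f' c a b * m a - f' c b a * m b) :
    ∀ a b c, m a * (f' c a b * m c + f' b a c * m b) = f b a c * ((m b) ^ 2 - (m c) ^ 2) := by
  intro a b c
  linear_combination -m c * hff' a b c - m b * hff' a c b
    + ((m c) ^ 2 - (m b) ^ 2) * hf1 a b c + (m b) ^ 2 * hf2 a b c + m b * m c * hf' c b a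
end

section
/- Assume relation (mass-f) holds. Then relation (f-f') holds if and only if both of the following hold: (i) for all a, b, c with m a ≠ 0 and m b ≠ 0, one has 2·(m a)·(m b)·(f' a b c) = ( (m a)² + (m b)² − (m c)² )·(f a b c); and (ii) there exists g : Fin r → Fin r → Fin r → ℝ, symmetric in its last two indices (g a b c = g a c b), such that for all a, b, c with m a = 0 and m b ≠ 0, f' a b c = (m c)·(g a b c). (In particular the constants f' a b c remain arbitrary for m a = m b = 0.) -/
/-- The relation (f-f') is completely equivalent to the explicit expressions
(f'1) and (f'2); in particular the constants `f' a b c` remain arbitrary for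
`m a = m b = 0`. -/
theorem stmt_6 (r : ℕ) (m : Fin r → ℝ) (f f' : Fin r → Fin r → Fin r → ℝ)
    (hf1 : ∀ a b c, f a b c = -f b a c) (hf2 : ∀ a b c, f a b c = -f a c b)
    (hf' : ∀ a b c, f' a b c = -f' b a c)
    (hmf : ∀ a b c, m c = 0 → (m a - m b) * f a b c = 0) :
    (∀ a b c, f a b c * m c = f' c a b * m a - f' c b a * m b) ↔
      ((∀ a b c, m a ≠ 0 → m b ≠ 0 →
          2 * m a * m b * f' a b c = ((m a) ^ 2 + (m b) ^ 2 - (m c) ^ 2) * f a b c) ∧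
       (∃ g : Fin r → Fin r → Fin r → ℝ, (∀ a b c, g a b c = g a c b) ∧
          ∀ a b c, m a = 0 → m b ≠ 0 → f' a b c = m c * g a b c)) := by
  have cyc1 : ∀ a b c, f b c a = f a b c := fun a b c => by
    rw [hf2 b c a, hf1 b a c, neg_neg]
  have cyc2 : ∀ a b c, f c a b = f a b c := fun a b c => by
    rw [hf1 c a b, hf2 a c b, neg_neg]
  constructor
  · intro h
    refine ⟨fun a b c _ _ => ?_,
      fun a b c => if m a = 0 then f' a b c * m b / (m b * m c) else 0,
      fun a b c => ?_, fun a b c ha hb => ?_⟩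
    · have h1 := h a b c
      have h2 := h b c a
      have h3 := h c a b
      rw [cyc1, hf' a c b] at h2
      rw [cyc2, hf' b a c] at h3
      rw [hf' c b a] at h1
      linear_combination -m a * h2 - m b * h3 + m c * h1
    · have h1 := h b c a
      dsimp only
      split_ifs with ha
      · rw [ha] at h1
        rw [mul_comm (m c) (m b), show f' a b c * m b = f' a c b * m c by linarith]
      · rfl
    · have h1 := h b c a
      rw [ha] at h1
      simp only [ha, if_true]
      by_cases hc : m c = 0
      · rw [hc] at h1 ⊢
        have : f' a b c * m b = 0 := by linarith
        simpa [hb] using this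
      · field_simp
  · rintro ⟨h, g, hg, hg'⟩ a b c
    by_cases hc : m c = 0
    · have key : ∀ x y, f' c x y * m x = m x * m y * g c x y := fun x y => by
        by_cases hx : m x = 0
        · simp [hx]
        · rw [hg' c x y hc hx]; ring
      rw [key a b, key b a, hg c b a, hc]
      ring
    have ha0 : m a = 0 → (m b - m c) * f a b c = 0 := fun ha => by
      simpa only [cyc1] using hmf b c a ha
    have hb0 : m b = 0 → (m c - m a) * f a b c = 0 := fun hb => by
      simpa only [cyc2] using hmf c a b hb
    have hca : m a ≠ 0 →
        2 * m c * m a * f' c a b = (m c ^ 2 + m a ^ 2 - m b ^ 2) * f a b c := fun ha => by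
      simpa only [cyc2] using h c a b hc ha
    have hcb : m b ≠ 0 →
        2 * m c * m b * f' c b a = -((m c ^ 2 + m b ^ 2 - m a ^ 2) * f a b c) := fun hb => by
      rw [h c b a hc hb, hf2 c b a, cyc2]; ring
    apply mul_left_cancel₀ (mul_ne_zero two_ne_zero hc)
    by_cases ha : m a = 0 <;> by_cases hb : m b = 0
    · have hF := ha0 ha
      rw [hb] at hF
      rw [ha, hb]
      linear_combination -2 * m c * hF
    · have hF := ha0 ha
      have hW := hcb hb
      rw [ha] at hW ⊢
      linear_combination hW - (m b + m c) * hF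
    · have hF := hb0 hb
      have hZ := hca ha
      rw [hb] at hZ ⊢
      linear_combination (m c + m a) * hF - hZ
    · linear_combination hcb hb - hca ha
end

section
/- In the standard-model setup, the masses of the heavy Bosons are constrained by m 1 = m 2 and m 1 = (m 3)·cos θ. (Part (a) of the theorem on the standard model: the two W-Bosons have equal mass, related to the Z-Boson mass through the Weinberg angle.) -/
/-- Part (a) of the theorem on the standard model: the two W-Bosons have equal
mass, related to the Z-Boson mass through the Weinberg angle. -/
theorem stmt_9 (θ g : ℝ) (hg : 0 < g) (hsin : Real.sin θ ≠ 0) (hcos : 0 < Real.cos θ)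
    (m : Fin 4 → ℝ) (hm0 : m 0 = 0) (hm1 : 0 < m 1) (hm2 : 0 < m 2) (hm3 : 0 < m 3)
    (f : Fin 4 → Fin 4 → Fin 4 → ℝ)
    (hf1 : ∀ a b c, f a b c = -f b a c) (hf2 : ∀ a b c, f a b c = -f a c b)
    (hf210 : f 2 1 0 = g * Real.sin θ) (hf321 : f 3 2 1 = g * Real.cos θ)
    (hf310 : f 3 1 0 = 0) (hf320 : f 3 2 0 = 0)
    (hfsupp : ∀ a b c : Fin 4, ({a, b, c} : Finset (Fin 4)) ≠ {0, 1, 2} →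
      ({a, b, c} : Finset (Fin 4)) ≠ {1, 2, 3} → f a b c = 0)
    (f' : Fin 4 → Fin 4 → Fin 4 → ℝ)
    (hf'anti : ∀ a b c, f' a b c = -f' b a c)
    (hff' : ∀ a b c, f a b c * m c = f' c a b * m a - f' c b a * m b)
    (hmassf : ∀ a b c, m c = 0 → (m a - m b) * f a b c = 0)
    (hrepr : ∀ a b d e, (∑ c, (f' d c a * f' c e b - f' d c b * f' c e a))
      = -∑ c, f a b c * f' d e c) :
    m 1 = m 2 ∧ m 1 = m 3 * Real.cos θ := by
  have hs : g * Real.sin θ ≠ 0 := mul_ne_zero hg.ne' hsin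
  have h12 : m 1 = m 2 := by
    have h := hmassf 2 1 0 hm0
    rw [hf210] at h
    linarith [(mul_eq_zero.mp h).resolve_right hs]
  refine ⟨h12, ?_⟩
  have hG : 0 < g * Real.cos θ := mul_pos hg hcos
  have hsq : (g * Real.sin θ) ^ 2 + (g * Real.cos θ) ^ 2 = g ^ 2 := by
    linear_combination g ^ 2 * Real.sin_sq_add_cos_sq θ
  have hf0 (a b : Fin 4) : f a b b = 0 := by linarith [hf2 a b b]
  have hf'0 (a c : Fin 4) : f' a a c = 0 := by linarith [hf'anti a a c]
  have hM := hm1.ne'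
  have hZ := hm3.ne'
  generalize g * Real.sin θ = S at *
  generalize hGG : g * Real.cos θ = G at *
  -- structure constants with a photon index or in cyclic order
  have f102 : f 1 0 2 = S := by linarith [hf1 1 0 2, hf2 0 1 2, hf1 0 2 1, hf2 2 0 1]
  have f103 : f 1 0 3 = 0 := by linarith [hf1 1 0 3, hf2 0 1 3, hf1 0 3 1, hf2 3 0 1]
  have f203 : f 2 0 3 = 0 := by linarith [hf1 2 0 3, hf2 0 2 3, hf1 0 3 2, hf2 3 0 2]
  have f132 : f 1 3 2 = G := by linarith [hf1 1 3 2, hf2 3 1 2]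
  have f213 : f 2 1 3 = G := by linarith [hf2 2 1 3, hf1 2 3 1]
  -- the photon acts by a rotation in the (1, 2)-plane
  have t210 : f' 2 1 0 = S := by
    have h := hff' 1 0 2
    rw [f102, hm0, ← h12] at h
    exact mul_right_cancel₀ hM (by linarith)
  have t310 : f' 3 1 0 = 0 := by
    have h := hff' 1 0 3
    rw [f103, hm0] at h
    exact mul_right_cancel₀ hM (by linarith)
  have t320 : f' 3 2 0 = 0 := by
    have h := hff' 2 0 3
    rw [f203, hm0, ← h12] at h
    exact mul_right_cancel₀ hM (by linarith)
  have taba (a b : Fin 4) (hb : m b ≠ 0) : f' a b a = 0 := by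
    have h := hff' a b a
    rw [hf'0, hf1 a b a, hf2 b a a, hf0] at h
    exact mul_right_cancel₀ hb (by linarith)
  have tbaa (a b : Fin 4) (hb : m b ≠ 0) : f' b a a = 0 := by
    rw [hf'anti, taba a b hb, neg_zero]
  have hM2 : m 2 ≠ 0 := hm2.ne'
  have e1 := hff' 3 2 1
  have e2 := hff' 1 3 2
  have e3 := hff' 2 1 3
  rw [hf321] at e1
  rw [f132] at e2
  rw [f213] at e3
  have t010 := taba 0 1 hM
  have t020 := taba 0 2 hM2
  have t030 := taba 0 3 hZ
  have t120 : f' 1 2 0 = -S := by rw [hf'anti, t210]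
  have f012 : f 0 1 2 = -S := by rw [hf1, f102]
  have f120 : f 1 2 0 = -S := by rw [hf1, hf210]
  have f123 : f 1 2 3 = -G := by rw [hf1, f213]
  have f011 : f 0 1 1 = 0 := hf0 0 1
  have f013 : f 0 1 3 = 0 := by rw [hf1, f103, neg_zero]
  have faba (a b : Fin 4) : f a b a = 0 := by rw [hf1, hf0, neg_zero]
  have f130 : f 1 3 0 = 0 := by rw [hf1, hf310, neg_zero]
  have f03 (c : Fin 4) : f 0 3 c = 0 := by
    fin_cases c <;> [exact faba 0 3; (show f 0 3 1 = 0); (show f 0 3 2 = 0); exact hf0 0 3]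
    · rw [hf2, f013, neg_zero]
    · linarith [hf2 0 3 2, hf1 0 2 3]
  -- the Higgs components are diagonal, with equal entries for the two W-bosons
  have y23 : f' 0 2 3 = 0 := by
    have h := hrepr 0 3 0 1
    simp only [Fin.sum_univ_four, f03, hf'0, t010, t020, t030, t210, t310] at h
    exact mul_right_cancel₀ hs (by linarith)
  have y13 : f' 0 1 3 = 0 := by
    have h := hrepr 0 3 0 2
    simp only [Fin.sum_univ_four, f03, hf'0, t010, t020, t030, t120, t320] at h
    exact mul_right_cancel₀ hs (by linarith)
  have y31 : f' 0 3 1 = 0 := by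
    have h := hff' 1 3 0
    rw [hm0, y13] at h
    exact mul_right_cancel₀ hZ (by linarith)
  have y32 : f' 0 3 2 = 0 := by
    have h := hff' 2 3 0
    rw [hm0, y23] at h
    exact mul_right_cancel₀ hZ (by linarith)
  have ysymm : f' 0 1 2 = f' 0 2 1 := by
    have h := hff' 1 2 0
    rw [hm0, ← h12] at h
    exact mul_right_cancel₀ hM (by linarith)
  have y21 : f' 0 2 1 = 0 := by
    have h := hrepr 0 1 0 1
    simp only [Fin.sum_univ_four, f012, f011, f013, faba, hf'0, t010, t020, t030, t210, t310,
      ysymm] at h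
    exact mul_right_cancel₀ hs (by linarith)
  have y12 : f' 0 1 2 = 0 := ysymm.trans y21
  have y22 : f' 0 2 2 = f' 0 1 1 := by
    have h := hrepr 0 1 0 2
    simp only [Fin.sum_univ_four, f012, f011, f013, faba, hf'0, t010, t020, t030, t120, t320] at h
    exact mul_right_cancel₀ hs (by linarith)
  have r03 := hrepr 1 2 0 3
  have r13 := hrepr 1 3 1 3
  have r12 := hrepr 1 2 1 2
  simp only [Fin.sum_univ_four, f120, f123, f132, f130, faba, hf0, hf'0, y12, y21, y13, y31,
    y32, y22, t030, t120, taba 1 2 hM2, taba 1 3 hZ, taba 2 3 hZ, tbaa 2 1 hM, tbaa 2 3 hZ, tbaa 3 1 hM,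
    tbaa 3 2 hM2, hf'anti 1 0, hf'anti 1 3 2, hf'anti 3 2 1] at r03 r13 r12
  rw [hf'anti 1 3 2, ← h12] at e1
  rw [hf'anti 2 1 3, ← h12] at e2
  rw [hf'anti 3 2 1, ← h12] at e3
  generalize f' 2 3 1 = x₁ at *
  generalize f' 3 1 2 = x₂ at *
  generalize f' 1 2 3 = x₃ at *
  generalize f' 0 1 1 = y at *
  generalize f' 0 3 3 = z at *
  have hx : x₂ = x₁ := mul_right_cancel₀ hZ (by linarith)
  subst hx
  have hGZ : G * m 3 = -2 * x₂ * m 1 := by linarith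
  have hx0 : x₂ < 0 := by
    have : 0 < -x₂ * m 1 := by linarith [mul_pos hG hm3]
    linarith [pos_of_mul_pos_left this hm1.le]
  have hx₃ : G * (x₃ + G) = 2 * x₂ ^ 2 :=
    mul_right_cancel₀ hM (by linear_combination G * e1 - x₂ * hGZ)
  have hy : y ^ 2 = x₂ ^ 2 :=
    mul_left_cancel₀ hx0.ne (by linear_combination (G * r13 - y * r03 + x₂ * hx₃) / 2)
  have hxg : -2 * x₂ = g := by
    have : (-2 * x₂) ^ 2 = g ^ 2 := by linear_combination hsq - r12 - hy - hx₃
    exact (sq_eq_sq₀ (by linarith) hg.le).mp this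
  refine mul_left_cancel₀ hg.ne' ?_
  linear_combination -hGZ - m 1 * hxg - m 3 * hGG
end

section
/- In the standard-model setup, the constants f' are completely determined up to a sign: there exists ε ∈ ℝ with ε = 1 or ε = −1 such that f' 0 1 1 = ε·g/2, f' 0 2 2 = ε·g/2, f' 0 3 3 = ε·g/(2·cos θ), f' 2 1 0 = g·sin θ, f' 3 2 1 = g/2, f' 3 1 2 = −g/2, f' 1 2 3 = −g·cos(2θ)/(2·cos θ), and f' a b c = 0 for every triple (a,b,c) such that neither (a,b,c) nor (b,a,c) belongs to the list {(0,1,1), (0,2,2), (0,3,3), (2,1,0), (3,2,1), (3,1,2), (1,2,3)}. (Part (b) of the theorem on the standard model.) -/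
/-- The list of (unordered, up to the antisymmetry in the first two indices)
index triples on which `f'` may be non-zero in the standard model. -/
def exceptionalTriples : List (Fin 4 × Fin 4 × Fin 4) :=
  [(0, 1, 1), (0, 2, 2), (0, 3, 3), (2, 1, 0), (3, 2, 1), (3, 1, 2), (1, 2, 3)]

/-- Part (b) of the theorem on the standard model: the constants `f'` are
completely determined up to a sign `ε = ±1`. -/
theorem stmt_10 (θ g : ℝ) (hg : 0 < g) (hsin : Real.sin θ ≠ 0) (hcos : 0 < Real.cos θ)
    (m : Fin 4 → ℝ) (hm0 : m 0 = 0) (hm1 : 0 < m 1) (hm2 : 0 < m 2) (hm3 : 0 < m 3)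
    (f : Fin 4 → Fin 4 → Fin 4 → ℝ)
    (hf1 : ∀ a b c, f a b c = -f b a c) (hf2 : ∀ a b c, f a b c = -f a c b)
    (hf210 : f 2 1 0 = g * Real.sin θ) (hf321 : f 3 2 1 = g * Real.cos θ)
    (hf310 : f 3 1 0 = 0) (hf320 : f 3 2 0 = 0)
    (hfsupp : ∀ a b c : Fin 4, ({a, b, c} : Finset (Fin 4)) ≠ {0, 1, 2} →
      ({a, b, c} : Finset (Fin 4)) ≠ {1, 2, 3} → f a b c = 0)
    (f' : Fin 4 → Fin 4 → Fin 4 → ℝ)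
    (hf'anti : ∀ a b c, f' a b c = -f' b a c)
    (hff' : ∀ a b c, f a b c * m c = f' c a b * m a - f' c b a * m b)
    (hmassf : ∀ a b c, m c = 0 → (m a - m b) * f a b c = 0)
    (hrepr : ∀ a b d e, (∑ c, (f' d c a * f' c e b - f' d c b * f' c e a))
      = -∑ c, f a b c * f' d e c) :
    ∃ ε : ℝ, (ε = 1 ∨ ε = -1) ∧
      f' 0 1 1 = ε * g / 2 ∧ f' 0 2 2 = ε * g / 2 ∧
      f' 0 3 3 = ε * g / (2 * Real.cos θ) ∧
      f' 2 1 0 = g * Real.sin θ ∧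
      f' 3 2 1 = g / 2 ∧ f' 3 1 2 = -g / 2 ∧
      f' 1 2 3 = -g * Real.cos (2 * θ) / (2 * Real.cos θ) ∧
      ∀ a b c : Fin 4, (a, b, c) ∉ exceptionalTriples → (b, a, c) ∉ exceptionalTriples →
        f' a b c = 0 := by
  have hsupp : ∀ a b c : Fin 4, ({a, b, c} : Finset (Fin 4)) ≠ {0, 1, 2} ∧
      ({a, b, c} : Finset (Fin 4)) ≠ {1, 2, 3} → f a b c = 0 :=
    fun a b c h => hfsupp a b c h.1 h.2
  have hmul : ∀ {a x : ℝ}, 0 < a → x * a = 0 → x = 0 := fun ha h =>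
    (mul_eq_zero.mp h).resolve_right ha.ne'
  have hs : g * Real.sin θ ≠ 0 := mul_ne_zero hg.ne' hsin
  have hk : 0 < g * Real.cos θ := mul_pos hg hcos
  have hnorm : (g * Real.sin θ) ^ 2 + (g * Real.cos θ) ^ 2 = g ^ 2 := by
    linear_combination g ^ 2 * Real.sin_sq_add_cos_sq θ
  have hcos2 := Real.cos_two_mul θ
  set s := g * Real.sin θ with hs_def
  set k := g * Real.cos θ with hk_def
  have hm21 : m 2 = m 1 := by
    have h := hmassf 2 1 0 hm0
    rw [hf210] at h
    linarith [(mul_eq_zero.mp h).resolve_right hs]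
  -- The values of `f` needed below.
  have f012 : f 0 1 2 = -s := by linarith [hf1 0 1 2, hf2 1 0 2, hf1 1 2 0]
  have f120 : f 1 2 0 = -s := by linarith [hf1 1 2 0]
  have f231 : f 2 3 1 = -k := by linarith [hf1 2 3 1]
  have f312 : f 3 1 2 = -k := by linarith [hf2 3 1 2]
  have f123 : f 1 2 3 = -k := by linarith [hf2 1 2 3, hf1 1 3 2]
  have hself : ∀ a c, f' a a c = 0 := fun a c => by linarith [hf'anti a a c]
  -- The entries `f' a b 0`.
  have hzero : ∀ b c, f' c b 0 * m b = -(f 0 b c * m c) := fun b c => by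
    rw [hff' 0 b c, hm0]; ring
  have z010 : f' 0 1 0 = 0 := hmul hm1 (by rw [hzero, hm0]; ring)
  have z020 : f' 0 2 0 = 0 := hmul hm2 (by rw [hzero, hm0]; ring)
  have z030 : f' 0 3 0 = 0 := hmul hm3 (by rw [hzero, hm0]; ring)
  have z130 : f' 1 3 0 = 0 := hmul hm3 (by rw [hzero, hsupp 0 3 1 (by decide)]; ring)
  have z230 : f' 2 3 0 = 0 := hmul hm3 (by rw [hzero, hsupp 0 3 2 (by decide)]; ring)
  have v210 : f' 2 1 0 = s := by
    have h := hzero 1 2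
    rw [f012, hm21] at h
    exact mul_right_cancel₀ hm1.ne' (by linarith)
  -- The entries `f' a b a` with `a`, `b` massive.
  have hrep : ∀ a b, f' a b a * m b = 0 := fun a b => by
    have h := hff' a b a
    rw [hself, hsupp a b a (by clear h; revert a b; decide)] at h
    linarith
  have z121 : f' 1 2 1 = 0 := hmul hm2 (hrep 1 2)
  have z131 : f' 1 3 1 = 0 := hmul hm3 (hrep 1 3)
  have z232 : f' 2 3 2 = 0 := hmul hm3 (hrep 2 3)
  have z122 : f' 1 2 2 = 0 := by rw [hf'anti, hmul hm1 (hrep 2 1), neg_zero]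
  have z133 : f' 1 3 3 = 0 := by rw [hf'anti, hmul hm1 (hrep 3 1), neg_zero]
  have z233 : f' 2 3 3 = 0 := by rw [hf'anti, hmul hm2 (hrep 3 2), neg_zero]
  -- The entries `f' 0 a b` with `a`, `b` massive are symmetric up to mass ratios.
  have hsymm : ∀ a b, f' 0 a b * m a = f' 0 b a * m b := fun a b => by
    have h := hff' a b 0
    rw [hm0] at h
    linarith
  have r10 : ∀ c, f' 1 0 c = -f' 0 1 c := fun c => hf'anti 1 0 c
  have r20 : ∀ c, f' 2 0 c = -f' 0 2 c := fun c => hf'anti 2 0 c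
  have r30 : ∀ c, f' 3 0 c = -f' 0 3 c := fun c => hf'anti 3 0 c
  have r21 : ∀ c, f' 1 2 c = -f' 2 1 c := fun c => hf'anti 1 2 c
  have r31 : ∀ c, f' 1 3 c = -f' 3 1 c := fun c => hf'anti 1 3 c
  have r32 : ∀ c, f' 2 3 c = -f' 3 2 c := fun c => hf'anti 2 3 c
  rw [r21, neg_eq_zero] at z121 z122
  rw [r31, neg_eq_zero] at z130 z131 z133
  rw [r32, neg_eq_zero] at z230 z232 z233
  have f03 : ∀ c, f 0 3 c = 0 := fun c => hsupp 0 3 c (by revert c; decide)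
  have z013 : f' 0 1 3 = 0 := by
    have h := hrepr 0 3 0 2
    simp only [Fin.sum_univ_four, f03, hself, r21, z010, z020, z030, z230, v210] at h
    exact (mul_eq_zero.mp (show f' 0 1 3 * s = 0 by linarith)).resolve_right hs
  have z023 : f' 0 2 3 = 0 := by
    have h := hrepr 0 3 0 1
    simp only [Fin.sum_univ_four, f03, hself, z010, z020, z030, z130, v210] at h
    exact (mul_eq_zero.mp (show f' 0 2 3 * s = 0 by linarith)).resolve_right hs
  have z031 : f' 0 3 1 = 0 := hmul hm3 (by rw [hsymm, z013, zero_mul])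
  have z032 : f' 0 3 2 = 0 := hmul hm3 (by rw [hsymm, z023, zero_mul])
  have h021 : f' 0 2 1 = f' 0 1 2 := by
    have h := hsymm 2 1
    rw [hm21] at h
    exact mul_right_cancel₀ hm1.ne' h
  have f010 : f 0 1 0 = 0 := hsupp 0 1 0 (by decide)
  have f011 : f 0 1 1 = 0 := hsupp 0 1 1 (by decide)
  have f013 : f 0 1 3 = 0 := hsupp 0 1 3 (by decide)
  have f121 : f 1 2 1 = 0 := hsupp 1 2 1 (by decide)
  have f122 : f 1 2 2 = 0 := hsupp 1 2 2 (by decide)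
  have f230 : f 2 3 0 = 0 := hsupp 2 3 0 (by decide)
  have f232 : f 2 3 2 = 0 := hsupp 2 3 2 (by decide)
  have f233 : f 2 3 3 = 0 := hsupp 2 3 3 (by decide)
  have z012 : f' 0 1 2 = 0 := by
    have h := hrepr 0 1 0 1
    simp only [Fin.sum_univ_four, f010, f011, f012, f013, hself, z010, z020, z030, z130,
      v210, h021] at h
    exact (mul_eq_zero.mp (show f' 0 1 2 * s = 0 by linarith)).resolve_right hs
  rw [z012] at h021
  have h022 : f' 0 2 2 = f' 0 1 1 := by
    have h := hrepr 0 1 0 2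
    simp only [Fin.sum_univ_four, f010, f011, f012, f013, hself, r21, z010, z020, z030,
      z230, v210] at h
    exact mul_right_cancel₀ hs (by linarith)
  -- The three entries with distinct massive indices, in terms of the mass ratio.
  have e123 := hff' 1 2 3
  have e231 := hff' 2 3 1
  have e312 := hff' 3 1 2
  rw [f123, hm21] at e123
  rw [f231, hm21, r21, r31] at e231
  rw [f312, hm21, r32] at e312
  have hzy : f' 3 1 2 = -f' 3 2 1 := mul_right_cancel₀ hm3.ne' (by linarith)
  rw [hzy] at e123 e231
  -- The commutation relations among the massive directions.
  have c12 := hrepr 1 2 1 2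
  have c03 := hrepr 1 2 0 3
  have c23 := hrepr 2 3 2 3
  simp only [Fin.sum_univ_four, f120, f121, f122, f123, f230, f231, f232, f233, hself, r10, r20,
    r21, r31, r32, z030, z230, v210, h021, h022, z012, z023, z031,
    z032, z121, z122, z131, z133, z232, z233, hzy] at c12 c03 c23
  obtain ⟨t, ht, hZ⟩ : ∃ t, 0 < t ∧ m 3 = t * m 1 :=
    ⟨m 3 / m 1, div_pos hm3 hm1, by field_simp⟩
  rw [hZ] at e123 e231
  have hy : f' 3 2 1 = k * t / 2 := mul_right_cancel₀ hm1.ne' (by linarith)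
  rw [hy] at e231 c12 c03 c23
  have hx : f' 2 1 3 = k - k * t ^ 2 / 2 := mul_right_cancel₀ hm1.ne' (by linarith)
  rw [hx] at c12 c23
  have hC : f' 0 3 3 = f' 0 1 1 * t := mul_left_cancel₀ hk.ne' (by linarith)
  rw [hC] at c23
  have hA : f' 0 1 1 ^ 2 = k ^ 2 * t ^ 2 / 4 := mul_right_cancel₀ ht.ne' (by linarith)
  have hkt : k * t = g := by
    have h : (k * t) ^ 2 = g ^ 2 := by linarith
    exact (pow_left_inj₀ (mul_pos hk ht).le hg.le two_ne_zero).mp h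
  have hct : Real.cos θ * t = 1 :=
    mul_left_cancel₀ hg.ne' (by rw [← mul_assoc, ← hk_def, hkt, mul_one])
  have ht' : t = 1 / Real.cos θ := by rw [← hct]; field_simp
  have hA' : f' 0 1 1 ^ 2 = (g / 2) ^ 2 := by rw [hA, ← hkt]; ring
  have hε : ∃ ε : ℝ, (ε = 1 ∨ ε = -1) ∧ f' 0 1 1 = ε * g / 2 := by
    rcases sq_eq_sq_iff_eq_or_eq_neg.mp hA' with h | h
    · exact ⟨1, Or.inl rfl, by rw [h]; ring⟩
    · exact ⟨-1, Or.inr rfl, by rw [h]; ring⟩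
  obtain ⟨ε, hε1, hε⟩ := hε
  refine ⟨ε, hε1, hε, h022.trans hε, ?_, v210, by rw [hy, hkt], by rw [hzy, hy, hkt]; ring, ?_, ?_⟩
  · rw [hC, hε, ht']; field_simp
  · rw [r21, hx, hcos2, ht', hk_def]; field_simp
  · intro a b c h1 h2
    fin_cases a <;> fin_cases b <;> fin_cases c <;>
      first
      | exact absurd (by decide) h1
      | exact absurd (by decide) h2
      | simp [hself, r10, r20, r30, r21, r31, r32, z010, z020, z030, z130, z230, h021, z012, z013,
          z023, z031, z032, z121, z122, z131, z133, z232, z233]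
end

section
/- In the standard-model setup, let m_H > 0 (the Higgs mass), set m* : Fin 4 → ℝ by m* 0 = m_H and m* a = m a for a = 1,2,3, and let f'' : Fin 4 → Fin 4 → Fin 4 → ℝ be totally symmetric and satisfy, for all a, b, c with m c ≠ 0: 6·(m c)·(f'' a b c) = (f' a b c)·( (m* a)² − (m* b)² − (m a)² + (m b)² ). Then: f'' a b c = 0 whenever a, b, c all lie in {1,2,3}; f'' 0 0 1 = f'' 0 0 2 = f'' 0 0 3 = f'' 0 1 2 = f'' 0 2 3 = f'' 0 3 1 = 0; and f'' 0 1 1 = f'' 0 2 2 = f'' 0 3 3 = (f' 0 1 1)·(m_H)²/(6·(m 1)). (Part (c) of the theorem on the standard model.) -/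
/-- Part (c) of the theorem on the standard model: the constants `f''` are
(partially) determined. -/
theorem stmt_11 (θ g : ℝ) (hg : 0 < g) (hsin : Real.sin θ ≠ 0) (hcos : 0 < Real.cos θ)
    (m : Fin 4 → ℝ) (hm0 : m 0 = 0) (hm1 : 0 < m 1) (hm2 : 0 < m 2) (hm3 : 0 < m 3)
    (f : Fin 4 → Fin 4 → Fin 4 → ℝ)
    (hf1 : ∀ a b c, f a b c = -f b a c) (hf2 : ∀ a b c, f a b c = -f a c b)
    (hf210 : f 2 1 0 = g * Real.sin θ) (hf321 : f 3 2 1 = g * Real.cos θ)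
    (hf310 : f 3 1 0 = 0) (hf320 : f 3 2 0 = 0)
    (hfsupp : ∀ a b c : Fin 4, ({a, b, c} : Finset (Fin 4)) ≠ {0, 1, 2} →
      ({a, b, c} : Finset (Fin 4)) ≠ {1, 2, 3} → f a b c = 0)
    (f' : Fin 4 → Fin 4 → Fin 4 → ℝ)
    (hf'anti : ∀ a b c, f' a b c = -f' b a c)
    (hff' : ∀ a b c, f a b c * m c = f' c a b * m a - f' c b a * m b)
    (hmassf : ∀ a b c, m c = 0 → (m a - m b) * f a b c = 0)
    (hrepr : ∀ a b d e, (∑ c, (f' d c a * f' c e b - f' d c b * f' c e a))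
      = -∑ c, f a b c * f' d e c)
    (mH : ℝ) (hmH : 0 < mH)
    (mstar : Fin 4 → ℝ) (hms0 : mstar 0 = mH) (hms : ∀ a : Fin 4, a ≠ 0 → mstar a = m a)
    (f'' : Fin 4 → Fin 4 → Fin 4 → ℝ)
    (hsym1 : ∀ a b c, f'' a b c = f'' b a c) (hsym2 : ∀ a b c, f'' a b c = f'' a c b)
    (heq : ∀ a b c, m c ≠ 0 → 6 * m c * f'' a b c =
      f' a b c * ((mstar a) ^ 2 - (mstar b) ^ 2 - (m a) ^ 2 + (m b) ^ 2)) :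
    (∀ a b c : Fin 4, a ≠ 0 → b ≠ 0 → c ≠ 0 → f'' a b c = 0) ∧
    f'' 0 0 1 = 0 ∧ f'' 0 0 2 = 0 ∧ f'' 0 0 3 = 0 ∧
    f'' 0 1 2 = 0 ∧ f'' 0 2 3 = 0 ∧ f'' 0 3 1 = 0 ∧
    f'' 0 1 1 = f' 0 1 1 * mH ^ 2 / (6 * m 1) ∧
    f'' 0 2 2 = f' 0 1 1 * mH ^ 2 / (6 * m 1) ∧
    f'' 0 3 3 = f' 0 1 1 * mH ^ 2 / (6 * m 1) := by
  have hsne : f 0 1 2 ≠ 0 := by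
    have h : f 0 1 2 = -(g * Real.sin θ) := by
      linarith [hf1 0 1 2, hf2 1 0 2, hf1 1 2 0]
    rw [h]
    exact neg_ne_zero.mpr (mul_ne_zero hg.ne' hsin)
  have hFne : f 2 3 1 ≠ 0 := by
    rw [hf1, hf321]
    exact neg_ne_zero.mpr (mul_pos hg hcos).ne'
  have f_cyc (a b c) : f a b c = f b c a := by
    rw [hf1 a b c, hf2 b a c, neg_neg]
  have f_diag (a c) : f a a c = 0 := by linarith [hf1 a a c]
  have f_diag_right (a c) : f a c c = 0 := by linarith [hf2 a c c]
  have f_diag_outer (a c) : f a c a = 0 := by rw [f_cyc, f_cyc, f_diag]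
  have hf03 (c) : f 0 3 c = 0 := by
    fin_cases c
    · exact f_diag_outer 0 3
    · change f 0 3 1 = 0
      rw [f_cyc, hf310]
    · change f 0 3 2 = 0
      rw [f_cyc, hf320]
    · exact f_diag_right 0 3
  have hm12 : m 2 = m 1 := by
    have h := hmassf 1 2 0 hm0
    rw [← f_cyc] at h
    linarith [(mul_eq_zero.mp h).resolve_right hsne]
  have f'_diag (a c) : f' a a c = 0 := by linarith [hf'anti a a c]
  have hm_ne (a : Fin 4) (ha : a ≠ 0) : m a ≠ 0 := by
    fin_cases a
    · exact absurd rfl ha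
    · exact hm1.ne'
    · exact hm2.ne'
    · exact hm3.ne'
  have f'_outer (a c) (ha : a ≠ 0) : f' c a c = 0 := by
    have h := hff' c a c
    rw [f_diag_outer, f'_diag] at h
    simpa [hm_ne a ha] using h
  have f'_right_zero (a c) : f' c a 0 * m a = f a 0 c * m c := by
    have h := hff' a 0 c
    rw [hm0] at h
    linarith
  have f'_zero_zero (c) : f' 0 c 0 = 0 := by
    by_cases hc : c = 0
    · rw [hc, f'_diag]
    · exact f'_outer c 0 hc
  have f'_130 : f' 1 3 0 = 0 := by
    have h := f'_right_zero 3 1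
    rw [← f_cyc 1 3 0, hf1, hf310] at h
    simpa [hm3.ne'] using h
  have f'_230 : f' 2 3 0 = 0 := by
    have h := f'_right_zero 3 2
    rw [← f_cyc 2 3 0, hf1, hf320] at h
    simpa [hm3.ne'] using h
  have f'_120 : f' 1 2 0 = f 0 1 2 := by
    have h := f'_right_zero 2 1
    rw [hm12, ← f_cyc 1 2 0, ← f_cyc 0 1 2] at h
    exact mul_right_cancel₀ hm1.ne' h
  have f'_symm (b c) : f' 0 b c * m b = f' 0 c b * m c := by
    have h := hff' b c 0
    rw [hm0] at h
    linarith
  have f'_023 : f' 0 2 3 = 0 := by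
    have h := hrepr 0 3 0 1
    simp only [Fin.sum_univ_four, hf03, f'_zero_zero, f'_diag, f'_130,
      hf'anti 3 1 0, hf'anti 2 1 0, f'_120] at h
    have : f' 0 2 3 * f 0 1 2 = 0 := by linarith
    exact (mul_eq_zero.mp this).resolve_right hsne
  have f'_013 : f' 0 1 3 = 0 := by
    have h := hrepr 0 3 0 2
    simp only [Fin.sum_univ_four, hf03, f'_zero_zero, f'_diag, f'_230,
      hf'anti 3 2 0, f'_120] at h
    have : f' 0 1 3 * f 0 1 2 = 0 := by linarith
    exact (mul_eq_zero.mp this).resolve_right hsne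
  have f'_031 : f' 0 3 1 = 0 := by
    have h := f'_symm 3 1
    rw [f'_013] at h
    simpa [hm3.ne'] using h
  have hf013 : f 0 1 3 = 0 := by rw [hf2, hf03, neg_zero]
  have f'_012 : f' 0 1 2 = 0 := by
    have h := hrepr 0 1 0 1
    simp only [Fin.sum_univ_four, hf013, f_diag_outer, f_diag_right, f'_zero_zero, f'_diag, f'_130,
      hf'anti 3 1 0, hf'anti 2 1 0, f'_120] at h
    have h12 := f'_symm 1 2
    rw [hm12] at h12
    have h12' := mul_right_cancel₀ hm1.ne' h12
    rw [← h12'] at h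
    have : f' 0 1 2 * f 0 1 2 = 0 := by linarith
    exact (mul_eq_zero.mp this).resolve_right hsne
  have f'_022 : f' 0 2 2 = f' 0 1 1 := by
    have h := hrepr 0 1 0 2
    simp only [Fin.sum_univ_four, hf013, f_diag_outer, f_diag_right, f'_zero_zero, f'_diag, f'_230,
      hf'anti 3 2 0, f'_120] at h
    apply mul_right_cancel₀ hsne
    linarith
  have f'_033 : f' 0 3 3 * m 1 = f' 0 1 1 * m 3 := by
    have h := hrepr 2 3 0 1
    have h312 := hff' 1 2 3
    have h123 := hff' 2 3 1
    have h231 := hff' 3 1 2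
    simp only [Fin.sum_univ_four, f_diag_outer, f_diag_right, f'_diag, f'_012, f'_022, f'_023,
      f'_013, f'_zero_zero, f'_outer 1 3 one_ne_zero, hf'anti 2 1 3] at h
    rw [f_cyc 1 2 3, hf'anti 3 2 1, hm12] at h312
    rw [hf'anti 1 3 2, hm12] at h123
    rw [← f_cyc 2 3 1, hf'anti 2 1 3, hm12] at h231
    have hsum : f 2 3 1 * m 3 = 2 * f' 3 1 2 * m 1 := by
      have hyz : f' 3 1 2 * m 3 = f' 2 3 1 * m 3 := by linarith
      have := mul_right_cancel₀ hm3.ne' hyz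
      rw [← this] at h312
      linarith
    have hcomm : f' 0 3 3 * f' 3 1 2 = f' 0 1 1 * (f 2 3 1 - f' 1 2 3) := by linarith
    have hne : f 2 3 1 * m 3 ≠ 0 := mul_ne_zero hFne hm3.ne'
    apply mul_right_cancel₀ hne
    linear_combination f' 0 3 3 * m 1 * hsum + 2 * m 1 ^ 2 * hcomm
      + 2 * m 1 * f' 0 1 1 * h123 - f' 0 1 1 * m 3 * hsum
  have eq_zero (b c : Fin 4) (hb : b ≠ 0) (hc : c ≠ 0) :
      6 * m c * f'' 0 b c = f' 0 b c * mH ^ 2 := by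
    rw [heq 0 b c (hm_ne c hc), hms0, hms b hb, hm0]
    ring
  have f''_zero_zero (c : Fin 4) (hc : c ≠ 0) : f'' 0 0 c = 0 := by
    have h := heq 0 0 c (hm_ne c hc)
    rw [f'_diag] at h
    simpa [hm_ne c hc] using h
  have f''_of_f' (b c : Fin 4) (hb : b ≠ 0) (hc : c ≠ 0) (h0 : f' 0 b c = 0) :
      f'' 0 b c = 0 := by
    have h := eq_zero b c hb hc
    rw [h0] at h
    simpa [hm_ne c hc] using h
  refine ⟨fun a b c ha hb hc => ?_, f''_zero_zero 1 (by decide), f''_zero_zero 2 (by decide),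
    f''_zero_zero 3 (by decide), f''_of_f' 1 2 (by decide) (by decide) f'_012,
    f''_of_f' 2 3 (by decide) (by decide) f'_023,
    f''_of_f' 3 1 (by decide) (by decide) f'_031, ?_, ?_, ?_⟩
  · have h := heq a b c (hm_ne c hc)
    rw [hms a ha, hms b hb] at h
    have h' : 6 * m c * f'' a b c = 0 := by linarith
    simpa [hm_ne c hc] using h'
  · rw [eq_div_iff (by positivity)]
    linarith [eq_zero 1 1 (by decide) (by decide)]
  · have h := eq_zero 2 2 (by decide) (by decide)
    rw [hm12, f'_022] at h
    rw [eq_div_iff (by positivity)]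
    linarith
  · have h := eq_zero 3 3 (by decide) (by decide)
    rw [eq_div_iff (by positivity)]
    apply mul_right_cancel₀ hm3.ne'
    linear_combination m 1 * h + mH ^ 2 * f'_033
end

section
/- In the massive-photon setup, assume g·sin θ ≠ 0 and assume the instance of relation (repr-f') with (a,b,d,e) = (0,1,0,1), i.e. ∑_c ( (f' 0 c 0)·(f' c 1 1) − (f' 0 c 1)·(f' c 1 0) ) = −∑_c (f 0 1 c)·(f' 0 1 c). Then the masses satisfy the quartic relation (m 0)⁴ + 2·( (m 2)² − (m 1)² )·(m 0)² + ( (m 1)² − (m 2)² )·( (m 1)² + 3·(m 2)² ) = 0. -/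
/-- In the massive-photon setup, the (0,1,0,1) instance of relation (repr-f')
forces the quartic mass relation (0011). -/
theorem stmt_13 (θ g : ℝ) (hgs : g * Real.sin θ ≠ 0)
    (m : Fin 4 → ℝ) (hm : ∀ a, m a ≠ 0)
    (f : Fin 4 → Fin 4 → Fin 4 → ℝ)
    (hf1 : ∀ a b c, f a b c = -f b a c) (hf2 : ∀ a b c, f a b c = -f a c b)
    (hf210 : f 2 1 0 = g * Real.sin θ) (hf321 : f 3 2 1 = g * Real.cos θ)
    (hf310 : f 3 1 0 = 0) (hf320 : f 3 2 0 = 0)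
    (hfsupp : ∀ a b c : Fin 4, ({a, b, c} : Finset (Fin 4)) ≠ {0, 1, 2} →
      ({a, b, c} : Finset (Fin 4)) ≠ {1, 2, 3} → f a b c = 0)
    (f' : Fin 4 → Fin 4 → Fin 4 → ℝ)
    (hf'def : ∀ a b c, f' a b c =
      ((m a) ^ 2 + (m b) ^ 2 - (m c) ^ 2) / (2 * m a * m b) * f a b c)
    (hinst : (∑ c, (f' 0 c 0 * f' c 1 1 - f' 0 c 1 * f' c 1 0))
      = -∑ c, f 0 1 c * f' 0 1 c) :
    (m 0) ^ 4 + 2 * ((m 2) ^ 2 - (m 1) ^ 2) * (m 0) ^ 2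
      + ((m 1) ^ 2 - (m 2) ^ 2) * ((m 1) ^ 2 + 3 * (m 2) ^ 2) = 0 := by
  have hdiag : ∀ a b, f a b b = 0 := fun a b => by linarith [hf2 a b b]
  have hdiag' : ∀ a b, f a a b = 0 := fun a b => by linarith [hf1 a a b]
  have h010 : f 0 1 0 = 0 := by rw [hf1, hdiag, neg_zero]
  have h031 : f 0 3 1 = 0 := by rw [hf1, hf2, hf310, neg_zero, neg_zero]
  have h013 : f 0 1 3 = 0 := by rw [hf2, h031, neg_zero]
  have h021 : f 0 2 1 = f 2 1 0 := by rw [hf1, hf2, neg_neg]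
  have h012 : f 0 1 2 = -f 2 1 0 := by rw [hf2, h021]
  have hs : f 2 1 0 ≠ 0 := hf210 ▸ hgs
  have h0 := hm 0
  have h1 := hm 1
  have h2 := hm 2
  simp only [Fin.sum_univ_four, hf'def, hdiag, hdiag', h010, h031, h013, h021, h012,
    mul_zero, zero_mul, zero_sub, add_zero, zero_add, neg_zero, neg_inj] at hinst
  field_simp at hinst
  linear_combination -hinst
end
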